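/- arXiv:2605.04484 — 4 statements merged into one kernel-verified Lean document; each statement's English description precedes it below -/
import Mathlib

section
/- (Lenard's projection inequality.) Let H be a complex Hilbert space, let P and Q be orthogonal projections on H (bounded self-adjoint idempotent operators), and let x ∈ H with ‖x‖ = 1. Then arccos ‖P x‖ + arccos ‖Q x‖ ≥ arccos ‖P ∘ Q‖, where ‖P ∘ Q‖ denotes the operator norm of the composition, and arccos is the real inverse cosine (note ‖Px‖ ≤ 1, ‖Qx‖ ≤ 1 and ‖P ∘ Q‖ ≤ 1, so all arccos values are defined). -/
open InnerProductGeometry in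
/-- A unit vector makes the angle `arccos ‖P x‖` with its image under an orthogonal projection. -/
lemma angle_apply_self_of_isSelfAdjoint_of_idem
    {H : Type*} [NormedAddCommGroup H] [InnerProductSpace ℂ H] [CompleteSpace H]
    {P : H →L[ℂ] H} (hP : IsSelfAdjoint P) (hPidem : P.comp P = P) {x : H} (hx : ‖x‖ = 1) :
    letI := InnerProductSpace.rclikeToReal ℂ H
    angle (P x) x = Real.arccos ‖P x‖ := by
  let := InnerProductSpace.rclikeToReal ℂ H
  have hinner : inner ℂ (P x) x = inner ℂ (P x) (P x) := by
    rw [← ContinuousLinearMap.adjoint_inner_left, hP.adjoint_eq,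
      ← ContinuousLinearMap.comp_apply, hPidem]
  rw [angle, real_inner_eq_re_inner ℂ, hinner, inner_self_eq_norm_sq, hx, mul_one, sq,
    mul_self_div_self]

open InnerProductGeometry in
/-- The angle between vectors in the ranges of two orthogonal projections is at least
`arccos ‖P ∘ Q‖`. -/
lemma arccos_norm_comp_le_angle
    {H : Type*} [NormedAddCommGroup H] [InnerProductSpace ℂ H] [CompleteSpace H]
    {P Q : H →L[ℂ] H} (hP : IsSelfAdjoint P) (hPidem : P.comp P = P)
    (hQidem : Q.comp Q = Q) (x y : H) :
    letI := InnerProductSpace.rclikeToReal ℂ H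
    Real.arccos ‖P.comp Q‖ ≤ angle (P x) (Q y) := by
  let := InnerProductSpace.rclikeToReal ℂ H
  have hinner : inner ℂ (P x) (Q y) = inner ℂ (P x) (P.comp Q (Q y)) := by
    rw [ContinuousLinearMap.comp_apply, ← ContinuousLinearMap.adjoint_inner_left P,
      hP.adjoint_eq, ← ContinuousLinearMap.comp_apply P P, hPidem,
      ← ContinuousLinearMap.comp_apply Q Q, hQidem]
  rw [angle, real_inner_eq_re_inner ℂ, hinner]
  refine Real.arccos_le_arccos (div_le_of_le_mul₀ (by positivity) (by positivity) ?_)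
  calc RCLike.re (inner ℂ (P x) (P.comp Q (Q y)))
      ≤ ‖P x‖ * ‖P.comp Q (Q y)‖ := re_inner_le_norm _ _
    _ ≤ ‖P x‖ * (‖P.comp Q‖ * ‖Q y‖) := by gcongr; exact (P.comp Q).le_opNorm _
    _ = ‖P.comp Q‖ * (‖P x‖ * ‖Q y‖) := by ring

/-- Lenard's projection inequality: for orthogonal projections `P`, `Q` on a complex
Hilbert space and a unit vector `x`,
`arccos ‖P x‖ + arccos ‖Q x‖ ≥ arccos ‖P ∘ Q‖`. -/
theorem lenard_projection_inequality
    {H : Type*} [NormedAddCommGroup H] [InnerProductSpace ℂ H] [CompleteSpace H]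
    (P Q : H →L[ℂ] H)
    (hP : IsSelfAdjoint P) (hPidem : P.comp P = P)
    (hQ : IsSelfAdjoint Q) (hQidem : Q.comp Q = Q)
    (x : H) (hx : ‖x‖ = 1) :
    Real.arccos ‖P.comp Q‖ ≤ Real.arccos ‖P x‖ + Real.arccos ‖Q x‖ := by
  let := InnerProductSpace.rclikeToReal ℂ H
  rw [← angle_apply_self_of_isSelfAdjoint_of_idem hP hPidem hx,
    ← angle_apply_self_of_isSelfAdjoint_of_idem hQ hQidem hx,
    InnerProductGeometry.angle_comm (Q x) x]
  exact (arccos_norm_comp_le_angle hP hPidem hQidem x x).trans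
    (InnerProductGeometry.angle_le_angle_add_angle _ _ _)
end

section
/- Let H be a complex Hilbert space, let P and Q be orthogonal projections on H, and let x ∈ H with ‖x‖ = 1. Suppose θx, θp ∈ (0,1] satisfy θx + θp > 1, ‖P x‖² ≥ θx, and ‖Q x‖² ≥ θp. Then the operator norm of P ∘ Q satisfies ‖P ∘ Q‖ ≥ √(θx θp) − √((1−θx)(1−θp)). -/
/-- An orthogonal projection satisfies `⟪P x, x⟫ = ‖P x‖²`. -/
lemma inner_apply_self_eq_norm_sq_of_idempotent
    {H : Type*} [NormedAddCommGroup H] [InnerProductSpace ℂ H] [CompleteSpace H]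
    {P : H →L[ℂ] H} (hP : IsSelfAdjoint P) (hPidem : P.comp P = P) (x : H) :
    inner ℂ (P x) x = (‖P x‖ : ℂ) ^ 2 := by
  have hPP : P (P x) = P x := congrArg (fun T : H →L[ℂ] H => T x) hPidem
  calc inner ℂ (P x) x = inner ℂ (P (P x)) x := by rw [hPP]
    _ = inner ℂ (P x) (P x) := hP.isSymmetric (P x) x
    _ = (‖P x‖ : ℂ) ^ 2 := inner_self_eq_norm_sq_to_K _

/-- The distance from `P x` to its component along the unit vector `x`. -/
lemma norm_sq_apply_sub_smul_of_idempotent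
    {H : Type*} [NormedAddCommGroup H] [InnerProductSpace ℂ H] [CompleteSpace H]
    {P : H →L[ℂ] H} (hP : IsSelfAdjoint P) (hPidem : P.comp P = P) {x : H} (hx : ‖x‖ = 1) :
    ‖P x - ((‖P x‖ : ℂ) ^ 2) • x‖ ^ 2 = ‖P x‖ ^ 2 * (1 - ‖P x‖ ^ 2) := by
  rw [norm_sub_sq (𝕜 := ℂ), inner_smul_right, inner_apply_self_eq_norm_sq_of_idempotent hP hPidem,
    norm_smul, hx]
  have h : RCLike.re ((‖P x‖ : ℂ) ^ 2 * (‖P x‖ : ℂ) ^ 2) = ‖P x‖ ^ 4 := by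
    rw [← pow_add]
    rw [← Complex.ofReal_pow]
    exact Complex.ofReal_re _
  rw [h]
  simp only [norm_pow, Complex.norm_real, norm_norm]
  ring


/-- If a unit vector `x` satisfies `‖P x‖² ≥ θx` and `‖Q x‖² ≥ θp` for orthogonal
projections `P`, `Q` with `θx + θp > 1`, then the operator norm of `P ∘ Q` is at least
`√(θx θp) − √((1−θx)(1−θp))`. -/
theorem opNorm_comp_projection_lower_bound
    {H : Type*} [NormedAddCommGroup H] [InnerProductSpace ℂ H] [CompleteSpace H]
    (P Q : H →L[ℂ] H)
    (hP : IsSelfAdjoint P) (hPidem : P.comp P = P)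
    (hQ : IsSelfAdjoint Q) (hQidem : Q.comp Q = Q)
    (x : H) (hx : ‖x‖ = 1)
    (θx θp : ℝ) (hθx : θx ∈ Set.Ioc (0:ℝ) 1) (hθp : θp ∈ Set.Ioc (0:ℝ) 1)
    (hsum : 1 < θx + θp)
    (hPx : θx ≤ ‖P x‖ ^ 2) (hQx : θp ≤ ‖Q x‖ ^ 2) :
    Real.sqrt (θx * θp) - Real.sqrt ((1 - θx) * (1 - θp)) ≤ ‖P.comp Q‖ := by
  have hPP := norm_sq_apply_sub_smul_of_idempotent hP hPidem hx
  have hQQ := norm_sq_apply_sub_smul_of_idempotent hQ hQidem hx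
  have hPi := inner_apply_self_eq_norm_sq_of_idempotent hP hPidem x
  have hQi := inner_apply_self_eq_norm_sq_of_idempotent hQ hQidem x
  have hQi' : inner ℂ x (Q x) = (‖Q x‖ : ℂ) ^ 2 := by
    rw [← hQi]
    exact (hQ.isSymmetric x x).symm
  have hxx : inner ℂ x x = (1 : ℂ) := by
    rw [inner_self_eq_norm_sq_to_K, hx]
    simp
  have hinner : inner ℂ (P x) (Q x) = (‖P x‖ : ℂ) ^ 2 * (‖Q x‖ : ℂ) ^ 2 +
      inner ℂ (P x - ((‖P x‖ : ℂ) ^ 2) • x) (Q x - ((‖Q x‖ : ℂ) ^ 2) • x) := by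
    simp only [inner_sub_left, inner_sub_right, inner_smul_left, inner_smul_right, hPi, hQi', hxx,
      map_pow, Complex.conj_ofReal]
    ring
  have hupper : ‖inner ℂ (P x) (Q x)‖ ≤ ‖P x‖ * ‖Q x‖ * ‖P.comp Q‖ := by
    have hPx' : P (P x) = P x := congrArg (fun T : H →L[ℂ] H => T x) hPidem
    have hQx' : Q (Q x) = Q x := congrArg (fun T : H →L[ℂ] H => T x) hQidem
    have h : inner ℂ (P x) (Q x) = inner ℂ (P x) (P.comp Q (Q x)) := by
      rw [ContinuousLinearMap.comp_apply, hQx']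
      conv_lhs => rw [← hPx']
      exact hP.isSymmetric (P x) (Q x)
    calc ‖inner ℂ (P x) (Q x)‖ ≤ ‖P x‖ * ‖P.comp Q (Q x)‖ := h ▸ norm_inner_le_norm _ _
      _ ≤ ‖P x‖ * (‖P.comp Q‖ * ‖Q x‖) := by
        gcongr
        exact (P.comp Q).le_opNorm _
      _ = ‖P x‖ * ‖Q x‖ * ‖P.comp Q‖ := by ring
  have hcs := norm_inner_le_norm (𝕜 := ℂ) (P x - ((‖P x‖ : ℂ) ^ 2) • x)
    (Q x - ((‖Q x‖ : ℂ) ^ 2) • x)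
  have htri := norm_sub_le (inner ℂ (P x) (Q x))
    (inner ℂ (P x - ((‖P x‖ : ℂ) ^ 2) • x) (Q x - ((‖Q x‖ : ℂ) ^ 2) • x))
  rw [sub_eq_of_eq_add hinner] at htri
  simp only [norm_mul, norm_pow, Complex.norm_real, norm_norm] at htri
  set a := ‖P x‖
  set b := ‖Q x‖
  have ha0 : 0 ≤ a := norm_nonneg _
  have hb0 : 0 ≤ b := norm_nonneg _
  have ha : 0 < a := lt_of_pow_lt_pow_left₀ 2 ha0 (by simpa using hθx.1.trans_le hPx)
  have hb : 0 < b := lt_of_pow_lt_pow_left₀ 2 hb0 (by simpa using hθp.1.trans_le hQx)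
  have ha1 : 0 ≤ 1 - a ^ 2 :=
    nonneg_of_mul_nonneg_right (hPP ▸ sq_nonneg _) (pow_pos ha 2)
  have hb1 : 0 ≤ 1 - b ^ 2 :=
    nonneg_of_mul_nonneg_right (hQQ ▸ sq_nonneg _) (pow_pos hb 2)
  have hresid : ‖P x - ((a : ℂ) ^ 2) • x‖ * ‖Q x - ((b : ℂ) ^ 2) • x‖ =
      a * b * Real.sqrt ((1 - a ^ 2) * (1 - b ^ 2)) := by
    rw [← sq_eq_sq₀ (by positivity) (by positivity), mul_pow, mul_pow, hPP, hQQ,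
      Real.sq_sqrt (mul_nonneg ha1 hb1)]
    ring
  have hlower : a * b - Real.sqrt ((1 - a ^ 2) * (1 - b ^ 2)) ≤ ‖P.comp Q‖ := by
    refine le_of_mul_le_mul_left ?_ (mul_pos ha hb)
    linarith
  have h₁ : Real.sqrt (θx * θp) ≤ a * b := by
    rw [Real.sqrt_le_left (by positivity), mul_pow]
    exact mul_le_mul hPx hQx hθp.1.le (sq_nonneg a)
  have h₂ : Real.sqrt ((1 - a ^ 2) * (1 - b ^ 2)) ≤ Real.sqrt ((1 - θx) * (1 - θp)) :=
    Real.sqrt_le_sqrt (mul_le_mul (by linarith) (by linarith) hb1 (by linarith))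
  linarith
end

section
/- (Asymptotic inversion, Corollary 1.) Let λ : (0,∞) → ℝ be strictly monotone increasing with λ(c) < 1 for all c > 0, and suppose (1 − λ(c)) · e^{2c} / (4 √(π c)) → 1 as c → ∞. For θ ∈ (0,1) define ℓ(θ) = ⨅ {c > 0 : λ(c) ≥ θ} (the set is nonempty since λ(c) → 1). Then ℓ(θ) / ( −(1/2) · ln(1 − θ) ) → 1 as θ → 1⁻. -/
open Filter Real

/-- If `1 - lam c ∼ 4 √(π c) e^{-2c}`, then `1 - lam c` eventually exceeds `e^{-2c}`. -/
theorem eventually_exp_neg_lt_one_sub {lam : ℝ → ℝ}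
    (hasymp : Tendsto (fun c => (1 - lam c) * Real.exp (2 * c) / (4 * Real.sqrt (Real.pi * c)))
      atTop (nhds 1)) :
    ∀ᶠ c in atTop, Real.exp (-(2 * c)) < 1 - lam c := by
  have hsqrt : Tendsto (fun c : ℝ => 4 * Real.sqrt (Real.pi * c)) atTop atTop :=
    (Real.tendsto_sqrt_atTop.comp (tendsto_id.const_mul_atTop Real.pi_pos)).const_mul_atTop
      (by norm_num)
  filter_upwards [(hasymp.pos_mul_atTop one_pos hsqrt).eventually_gt_atTop 1,
    hsqrt.eventually_gt_atTop 0] with c hc hpos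
  rw [div_mul_cancel₀ _ hpos.ne'] at hc
  rwa [Real.exp_neg, inv_lt_iff_one_lt_mul₀ (Real.exp_pos _)]

/-- If `1 - lam c ∼ 4 √(π c) e^{-2c}` and `b < 2`, then `1 - lam c` is eventually below
`e^{-bc}`. -/
theorem eventually_one_sub_lt_exp_neg {lam : ℝ → ℝ}
    (hasymp : Tendsto (fun c => (1 - lam c) * Real.exp (2 * c) / (4 * Real.sqrt (Real.pi * c)))
      atTop (nhds 1)) {b : ℝ} (hb : b < 2) :
    ∀ᶠ c in atTop, 1 - lam c < Real.exp (-(b * c)) := by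
  have hdecay := (tendsto_rpow_mul_exp_neg_mul_atTop_nhds_zero (1 / 2) (2 - b)
    (sub_pos.2 hb)).const_mul (4 * Real.sqrt Real.pi)
  have hprod := hasymp.mul hdecay
  rw [mul_zero, mul_zero] at hprod
  filter_upwards [hprod.eventually_lt_const one_pos, eventually_gt_atTop 0] with c hc hpos
  have hne : 4 * Real.sqrt (Real.pi * c) ≠ 0 := by positivity
  have hexp : Real.exp (-(2 - b) * c) = Real.exp (b * c) / Real.exp (2 * c) := by
    rw [← Real.exp_sub]
    ring_nf
  have heq : (1 - lam c) * Real.exp (2 * c) / (4 * Real.sqrt (Real.pi * c)) *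
      (4 * Real.sqrt Real.pi * (c ^ (1 / 2 : ℝ) * Real.exp (-(2 - b) * c))) =
      (1 - lam c) * Real.exp (b * c) := by
    rw [← Real.sqrt_eq_rpow, hexp, ← mul_assoc (4 * Real.sqrt Real.pi), mul_assoc 4,
      ← Real.sqrt_mul Real.pi_pos.le]
    field_simp
  rw [heq] at hc
  rwa [Real.exp_neg, ← one_div, lt_div_iff₀ (Real.exp_pos _)]

/-- Asymptotic inversion: if `lam` is strictly increasing on `(0,∞)`, bounded by `1`,
and `1 − lam(c) ∼ 4√(πc) e^{−2c}` as `c → ∞`, then the generalized inverse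
`ℓ(θ) = inf {c > 0 : lam(c) ≥ θ}` satisfies `ℓ(θ) ∼ −(1/2) ln(1−θ)` as `θ → 1⁻`. -/
theorem asymptotic_inversion
    (lam : ℝ → ℝ) (hmono : StrictMonoOn lam (Set.Ioi 0))
    (hlt : ∀ c > 0, lam c < 1)
    (hasymp : Tendsto (fun c => (1 - lam c) * Real.exp (2 * c) / (4 * Real.sqrt (Real.pi * c)))
      atTop (nhds 1)) :
    Tendsto (fun θ => sInf {c : ℝ | 0 < c ∧ θ ≤ lam c} / (-(1 / 2) * Real.log (1 - θ)))
      (nhdsWithin 1 (Set.Iio 1)) (nhds 1) := by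
  have hlog : Tendsto (fun θ : ℝ => -(1 / 2) * Real.log (1 - θ))
      (nhdsWithin 1 (Set.Iio 1)) atTop := by
    refine Tendsto.const_mul_atBot_of_neg (by norm_num) (Real.tendsto_log_nhdsGT_zero.comp ?_)
    refine tendsto_nhdsWithin_iff.2 ⟨?_, ?_⟩
    · have hcont : Continuous fun θ : ℝ => 1 - θ := by fun_prop
      simpa using (hcont.tendsto 1).mono_left nhdsWithin_le_nhds
    · filter_upwards [self_mem_nhdsWithin] with θ hθ
      exact sub_pos.2 (Set.mem_Iio.1 hθ)
  have hθ_eq : ∀ θ : ℝ, θ < 1 → Real.exp (-(2 * (-(1 / 2) * Real.log (1 - θ)))) = 1 - θ := by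
    intro θ hθ
    rw [show -(2 * (-(1 / 2) * Real.log (1 - θ))) = Real.log (1 - θ) by ring,
      Real.exp_log (sub_pos.2 hθ)]
  have hmem : ∀ r : ℝ, 1 < r → ∀ᶠ θ in nhdsWithin 1 (Set.Iio 1),
      r * (-(1 / 2) * Real.log (1 - θ)) ∈ {c : ℝ | 0 < c ∧ θ ≤ lam c} := by
    intro r hr
    have hr0 : 0 < r := one_pos.trans hr
    have hb : 2 / r < 2 := div_lt_self two_pos hr
    filter_upwards [(hlog.const_mul_atTop hr0).eventually (eventually_one_sub_lt_exp_neg hasymp hb),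
      hlog.eventually_gt_atTop 0, self_mem_nhdsWithin] with θ hθ hpos hθ1
    rw [← mul_assoc (2 / r), div_mul_cancel₀ _ hr0.ne', hθ_eq θ hθ1] at hθ
    exact ⟨mul_pos hr0 hpos, by linarith⟩
  refine tendsto_order.2 ⟨fun a ha => ?_, fun a ha => ?_⟩
  · filter_upwards [hmem 2 one_lt_two, hlog.eventually (eventually_exp_neg_lt_one_sub hasymp),
      hlog.eventually_gt_atTop 0, self_mem_nhdsWithin] with θ hne hθ hpos hθ1
    rw [hθ_eq θ hθ1] at hθ
    refine ha.trans_le ((one_le_div hpos).2 (le_csInf ⟨_, hne⟩ ?_))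
    rintro c ⟨hc, hθc⟩
    by_contra! hc_lt
    linarith [hmono hc hpos hc_lt]
  · filter_upwards [hmem ((1 + a) / 2) (by linarith), hlog.eventually_gt_atTop 0] with θ hθ hpos
    rw [div_lt_iff₀ hpos]
    have hbdd : BddBelow {c : ℝ | 0 < c ∧ θ ≤ lam c} := ⟨0, fun c hc => hc.1.le⟩
    exact (csInf_le hbdd hθ).trans_lt (mul_lt_mul_of_pos_right (by linarith) hpos)
end

section
/- Let θx, θp ∈ [0,1] with θx + θp > 1. Then √(θx θp) − √((1−θx)(1−θp)) ≥ 1 − √(1−θx) − √(1−θp), with strict inequality unless θx = θp = 1. -/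
theorem one_sub_mul_one_sub_le_sqrt {a b : ℝ} (ha : 0 ≤ a) (hb : 0 ≤ b) (ha1 : a ≤ 1)
    (hb1 : b ≤ 1) : (1 - a) * (1 - b) ≤ Real.sqrt ((1 - a ^ 2) * (1 - b ^ 2)) := by
  apply Real.le_sqrt_of_sq_le
  have h : 0 ≤ (1 - a) * (1 - b) * (a + b) :=
    mul_nonneg (mul_nonneg (sub_nonneg.2 ha1) (sub_nonneg.2 hb1)) (add_nonneg ha hb)
  linear_combination 2 * h

theorem one_sub_mul_one_sub_lt_sqrt {a b : ℝ} (hab : 0 < a + b) (ha1 : a < 1) (hb1 : b < 1) :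
    (1 - a) * (1 - b) < Real.sqrt ((1 - a ^ 2) * (1 - b ^ 2)) := by
  apply Real.lt_sqrt_of_sq_lt
  have h : 0 < (1 - a) * (1 - b) * (a + b) :=
    mul_pos (mul_pos (sub_pos.2 ha1) (sub_pos.2 hb1)) hab
  linear_combination 2 * h

/-- The Landau–Pollak angular quantity dominates the Donoho–Stark quantity:
for `θx, θp ∈ [0,1]` with `θx + θp > 1`,
`√(θxθp) − √((1−θx)(1−θp)) ≥ 1 − √(1−θx) − √(1−θp)`,
strictly unless `θx = θp = 1`. -/
theorem angular_dominates_donoho_stark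
    (θx θp : ℝ) (hθx : θx ∈ Set.Icc (0:ℝ) 1) (hθp : θp ∈ Set.Icc (0:ℝ) 1)
    (hsum : 1 < θx + θp) :
    1 - Real.sqrt (1 - θx) - Real.sqrt (1 - θp)
        ≤ Real.sqrt (θx * θp) - Real.sqrt ((1 - θx) * (1 - θp)) ∧
      (¬(θx = 1 ∧ θp = 1) →
        1 - Real.sqrt (1 - θx) - Real.sqrt (1 - θp)
          < Real.sqrt (θx * θp) - Real.sqrt ((1 - θx) * (1 - θp))) := by
  obtain ⟨hx0, hx1⟩ := hθx
  obtain ⟨hp0, hp1⟩ := hθp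
  have ha := Real.sqrt_nonneg (1 - θx)
  have hb := Real.sqrt_nonneg (1 - θp)
  have ha1 : Real.sqrt (1 - θx) < 1 := (Real.sqrt_lt' one_pos).2 (by linarith)
  have hb1 : Real.sqrt (1 - θp) < 1 := (Real.sqrt_lt' one_pos).2 (by linarith)
  have hx : 1 - Real.sqrt (1 - θx) ^ 2 = θx := by
    rw [Real.sq_sqrt (sub_nonneg.2 hx1)]; ring
  have hp : 1 - Real.sqrt (1 - θp) ^ 2 = θp := by
    rw [Real.sq_sqrt (sub_nonneg.2 hp1)]; ring
  rw [Real.sqrt_mul (sub_nonneg.2 hx1)]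
  refine ⟨?_, fun hne => ?_⟩
  · have h := one_sub_mul_one_sub_le_sqrt ha hb ha1.le hb1.le
    rw [hx, hp] at h
    linarith
  · have hab : 0 < Real.sqrt (1 - θx) + Real.sqrt (1 - θp) := by
      rcases hx1.lt_or_eq with hlt | heq
      · exact add_pos_of_pos_of_nonneg (Real.sqrt_pos.2 (sub_pos.2 hlt)) hb
      · have hlt : θp < 1 := hp1.lt_of_ne fun h => hne ⟨heq, h⟩
        exact add_pos_of_nonneg_of_pos ha (Real.sqrt_pos.2 (sub_pos.2 hlt))
    have h := one_sub_mul_one_sub_lt_sqrt hab ha1 hb1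
    rw [hx, hp] at h
    linarith
end
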